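/- Let I be the radical homogeneous ideal of a finite nonempty set Z of points in the complex projective plane ℙ². Then the initial sequence of I is strictly increasing: for every integer m ≥ 1 one has α(I^(m)) < α(I^(m+1)). -/

import Mathlib

open scoped LinearAlgebra.Projectivization

/-- A polynomial `F` vanishes to order at least `m` at the (affine representative) point
`v`: all iterated partial derivatives of order `≤ m - 1` (i.e. of order `< m`) vanish at `v`. -/
def VanishesToOrder (m : ℕ) (F : MvPolynomial (Fin 3) ℂ) (v : Fin 3 → ℂ) : Prop :=
  ∀ k : ℕ, k < m → ∀ d : Fin k → Fin 3,
    MvPolynomial.eval v ((List.ofFn d).foldl (fun p i => MvPolynomial.pderiv i p) F) = 0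

/-- The `m`-th symbolic power of the (radical) ideal of a set `Z` of points of `ℙ²`:
all polynomials vanishing to order at least `m` at every point of `Z`. -/
def symbolicPower (Z : Set (ℙ ℂ (Fin 3 → ℂ))) (m : ℕ) : Set (MvPolynomial (Fin 3) ℂ) :=
  {F | ∀ P ∈ Z, ∀ (v : Fin 3 → ℂ) (hv : v ≠ 0),
    Projectivization.mk ℂ v hv = P → VanishesToOrder m F v}

/-- The initial degree `α` of a set of polynomials: the least `t` such that the set contains
a nonzero homogeneous polynomial of degree `t`. -/
noncomputable def initialDegree (S : Set (MvPolynomial (Fin 3) ℂ)) : ℕ :=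
  sInf {t | ∃ F ∈ S, F ≠ 0 ∧ F.IsHomogeneous t}

namespace VanishesToOrder

variable {m : ℕ} {F G : MvPolynomial (Fin 3) ℂ} {v : Fin 3 → ℂ}

theorem zero_order (F : MvPolynomial (Fin 3) ℂ) (v : Fin 3 → ℂ) : VanishesToOrder 0 F v :=
  fun k hk => absurd hk (Nat.not_lt_zero k)

theorem mono {n : ℕ} (h : VanishesToOrder n F v) (hmn : m ≤ n) : VanishesToOrder m F v :=
  fun k hk => h k (hk.trans_le hmn)

theorem succ_iff : VanishesToOrder (m + 1) F v ↔
    MvPolynomial.eval v F = 0 ∧ ∀ i, VanishesToOrder m (MvPolynomial.pderiv i F) v := by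
  constructor
  · intro h
    refine ⟨by simpa using h 0 m.succ_pos Fin.elim0, fun i k hk d => ?_⟩
    simpa [List.ofFn_succ] using h (k + 1) (Nat.succ_lt_succ hk) (Fin.cons i d)
  · rintro ⟨h0, h⟩ k hk d
    cases k with
    | zero => simpa using h0
    | succ k => simpa [List.ofFn_succ] using h (d 0) k (Nat.lt_of_succ_lt_succ hk) fun j => d j.succ

theorem add (hF : VanishesToOrder m F v) (hG : VanishesToOrder m G v) :
    VanishesToOrder m (F + G) v := by
  induction m generalizing F G with
  | zero => exact zero_order _ _
  | succ m ih =>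
    rw [succ_iff] at hF hG ⊢
    exact ⟨by simp [hF.1, hG.1], fun i => by simpa using ih (hF.2 i) (hG.2 i)⟩

theorem mul_right (hF : VanishesToOrder m F v) (G : MvPolynomial (Fin 3) ℂ) :
    VanishesToOrder m (F * G) v := by
  induction m generalizing F G with
  | zero => exact zero_order _ _
  | succ m ih =>
    have hF' := succ_iff.1 hF
    refine succ_iff.2 ⟨by simp [hF'.1], fun i => ?_⟩
    rw [MvPolynomial.pderiv_mul]
    exact (ih (hF'.2 i) G).add (ih (hF.mono m.le_succ) _)

theorem mul_of_eval_eq_zero (hF : VanishesToOrder m F v) (hG : MvPolynomial.eval v G = 0) :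
    VanishesToOrder (m + 1) (F * G) v := by
  induction m generalizing F with
  | zero => exact succ_iff.2 ⟨by simp [hG], fun i => zero_order _ _⟩
  | succ m ih =>
    refine succ_iff.2 ⟨by simp [hG], fun i => ?_⟩
    rw [MvPolynomial.pderiv_mul]
    exact (ih ((succ_iff.1 hF).2 i)).add (hF.mul_right _)

theorem pow_of_eval_eq_zero (hG : MvPolynomial.eval v G = 0) (m : ℕ) :
    VanishesToOrder m (G ^ m) v := by
  induction m with
  | zero => exact zero_order _ _
  | succ m ih => exact pow_succ G m ▸ ih.mul_of_eval_eq_zero hG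

end VanishesToOrder

theorem exists_linearForm_vanishing (P : ℙ ℂ (Fin 3 → ℂ)) :
    ∃ L : MvPolynomial (Fin 3) ℂ, L ≠ 0 ∧ L.IsHomogeneous 1 ∧
      ∀ (v : Fin 3 → ℂ) (hv : v ≠ 0), Projectivization.mk ℂ v hv = P →
        MvPolynomial.eval v L = 0 := by
  induction P using Projectivization.ind with
  | h w hw =>
    by_cases h0 : w 0 = 0
    · refine ⟨.X 0, MvPolynomial.X_ne_zero 0, MvPolynomial.isHomogeneous_X _ _, ?_⟩
      intro v hv h
      obtain ⟨a, rfl⟩ := (Projectivization.mk_eq_mk_iff' ℂ _ _ hv hw).1 h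
      simp [h0]
    · refine ⟨MvPolynomial.C (w 1) * MvPolynomial.X 0 - MvPolynomial.C (w 0) * MvPolynomial.X 1,
        fun h => h0 ?_, MvPolynomial.IsHomogeneous.sub (MvPolynomial.isHomogeneous_C_mul_X _ _)
          (MvPolynomial.isHomogeneous_C_mul_X _ _), ?_⟩
      · simpa using congrArg (MvPolynomial.eval ![0, 1, 0]) h
      · intro v hv h
        obtain ⟨a, rfl⟩ := (Projectivization.mk_eq_mk_iff' ℂ _ _ hv hw).1 h
        simp only [map_sub, map_mul, MvPolynomial.eval_C, MvPolynomial.eval_X, Pi.smul_apply,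
          smul_eq_mul]
        ring

theorem exists_isHomogeneous_mem_symbolicPower {Z : Set (ℙ ℂ (Fin 3 → ℂ))} (hfin : Z.Finite)
    (m : ℕ) : ∃ t, ∃ F ∈ symbolicPower Z m, F ≠ 0 ∧ F.IsHomogeneous t := by
  choose L hL0 hL1 hL using exists_linearForm_vanishing
  refine ⟨_, (∏ P ∈ hfin.toFinset, L P) ^ m, ?_,
    pow_ne_zero _ (Finset.prod_ne_zero_iff.2 fun P _ => hL0 P),
    (MvPolynomial.IsHomogeneous.prod _ _ _ fun P _ => hL1 P).pow m⟩
  intro P hP v hv h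
  refine VanishesToOrder.pow_of_eval_eq_zero ?_ m
  rw [map_prod]
  exact Finset.prod_eq_zero (hfin.mem_toFinset.2 hP) (hL P v hv h)

theorem pderiv_mem_symbolicPower {Z : Set (ℙ ℂ (Fin 3 → ℂ))} {m : ℕ}
    {F : MvPolynomial (Fin 3) ℂ} (hF : F ∈ symbolicPower Z (m + 1)) (i : Fin 3) :
    MvPolynomial.pderiv i F ∈ symbolicPower Z m :=
  fun P hP v hv h => (VanishesToOrder.succ_iff.1 (hF P hP v hv h)).2 i

theorem exists_pderiv_ne_zero_of_isHomogeneous {F : MvPolynomial (Fin 3) ℂ} {t : ℕ}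
    (hF : F.IsHomogeneous t) (hF0 : F ≠ 0) (ht : t ≠ 0) :
    ∃ i, MvPolynomial.pderiv i F ≠ 0 := by
  by_contra! h
  have euler := hF.sum_X_mul_pderiv
  simp [h, hF0, ht] at euler

theorem degree_ne_zero_of_mem_symbolicPower {Z : Set (ℙ ℂ (Fin 3 → ℂ))} (hne : Z.Nonempty)
    {m t : ℕ} {F : MvPolynomial (Fin 3) ℂ} (hF : F ∈ symbolicPower Z (m + 1)) (hF0 : F ≠ 0)
    (hFt : F.IsHomogeneous t) : t ≠ 0 := by
  rintro rfl
  obtain ⟨P, hP⟩ := hne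
  have h := (VanishesToOrder.succ_iff.1 (hF P hP P.rep P.rep_nonzero P.mk_rep)).1
  rw [MvPolynomial.totalDegree_eq_zero_iff_eq_C.1 (hFt.totalDegree hF0)] at h hF0
  simp_all

/-- For a finite nonempty set `Z` of points of the complex projective plane, the initial
sequence `m ↦ α(I^(m))` of its radical ideal is strictly increasing. -/
theorem initialSequence_strictMono (Z : Set (ℙ ℂ (Fin 3 → ℂ)))
    (hfin : Z.Finite) (hne : Z.Nonempty) :
    ∀ m : ℕ, 1 ≤ m →
      initialDegree (symbolicPower Z m) < initialDegree (symbolicPower Z (m + 1)) := by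
  intro m _
  obtain ⟨F, hF, hF0, hFt⟩ := Nat.sInf_mem (exists_isHomogeneous_mem_symbolicPower hfin (m + 1))
  have ht := degree_ne_zero_of_mem_symbolicPower hne hF hF0 hFt
  obtain ⟨i, hi⟩ := exists_pderiv_ne_zero_of_isHomogeneous hFt hF0 ht
  refine lt_of_le_of_lt ?_ (Nat.sub_one_lt ht)
  exact Nat.sInf_le ⟨_, pderiv_mem_symbolicPower hF i, hi, hFt.pderiv⟩
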